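/- Let p ≥ 1, let n : Fin p → ℕ with n i ≥ 1 for all i, let λ : Fin p → ℝ, let σ = Σ i, Fin (n i), let N = Σ i, n i, and let 𝒥 = Matrix.blockDiagonal' (fun i => J_{n i}(λ i)) on σ. Assume N is even. Then there exists a skew-symmetric invertible real matrix B on σ with B * 𝒥 + 𝒥ᵀ * B = 0 if and only if both: (1) for every odd l, the number of indices i with n i = l and λ i = 0 is even; and (2) for every l ≥ 1 and every μ ∈ ℝ, the number of indices i with n i = l and λ i = μ equals the number of indices i with n i = l and λ i = −μ. -/

import Mathlib

open Matrix

noncomputable section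

/-- The `n×n` real Jordan block with eigenvalue `λ` (0-based indices). -/
def jordanBlock (n : ℕ) (lam : ℝ) : Matrix (Fin n) (Fin n) ℝ :=
  Matrix.of fun i j => if j = i then lam else if (j : ℕ) = (i : ℕ) + 1 then 1 else 0

/-- The real Jordan block `C_n(a,b)` for a complex eigenvalue `a ± i b`, as a matrix of
`2×2` blocks indexed by `Fin n × Fin 2`. -/
def realJordanBlock (n : ℕ) (a b : ℝ) : Matrix (Fin n × Fin 2) (Fin n × Fin 2) ℝ :=
  Matrix.of fun p q =>
    if q.1 = p.1 then !![a, b; -b, a] p.2 q.2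
    else if (q.1 : ℕ) = (p.1 : ℕ) + 1 then (1 : Matrix (Fin 2) (Fin 2) ℝ) p.2 q.2
    else 0

/-- The canonical `2`-form of rank `R` (for `R` even, `R ≤ N`): the `N×N` matrix whose
top-left `R×R` block is `[[0, I_{R/2}], [-I_{R/2}, 0]]` and whose other entries vanish. -/
def canonJ (N R : ℕ) : Matrix (Fin N) (Fin N) ℝ :=
  Matrix.of fun i j =>
    if (i : ℕ) < R / 2 ∧ (j : ℕ) = (i : ℕ) + R / 2 then 1
    else if (j : ℕ) < R / 2 ∧ (i : ℕ) = (j : ℕ) + R / 2 then -1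
    else 0


lemma exists_pairing {p : ℕ} (n : Fin p → ℕ) (lam : Fin p → ℝ) :
    ∀ (c : ℕ) (S : Finset (Fin p)), S.card = c →
    (∀ l : ℕ, Odd l → Even (S.filter (fun i => n i = l ∧ lam i = 0)).card) →
    (∀ l : ℕ, ∀ μ : ℝ, (S.filter (fun i => n i = l ∧ lam i = μ)).card
            = (S.filter (fun i => n i = l ∧ lam i = -μ)).card) →
    ∃ τ : Fin p → Fin p, ∀ i ∈ S, τ i ∈ S ∧ τ (τ i) = i ∧ n (τ i) = n i ∧ lam (τ i) = - lam i ∧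
      (τ i = i → Even (n i)) := by
  intro c
  induction c using Nat.strong_induction_on with
  | _ c ih =>
  intro S hS h1 h2
  rcases S.eq_empty_or_nonempty with rfl | ⟨i, hi⟩
  · exact ⟨id, by simp⟩
  have key : ∃ j ∈ S, n j = n i ∧ lam j = - lam i ∧ (j = i → Even (n i)) := by
    by_cases hl : lam i = 0
    · by_cases he : Even (n i)
      · exact ⟨i, hi, rfl, by simp [hl], fun _ => he⟩
      · have h := h1 (n i) (Nat.not_even_iff_odd.1 he)
        have hmem : i ∈ S.filter (fun k => n k = n i ∧ lam k = 0) := by simp [hi, hl]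
        have hpos := Finset.card_pos.2 ⟨i, hmem⟩
        have h2' : 1 < (S.filter (fun k => n k = n i ∧ lam k = 0)).card := by
          rcases h with ⟨r, hr⟩; omega
        obtain ⟨j, hj, hji⟩ := Finset.exists_mem_ne h2' i
        simp only [Finset.mem_filter] at hj
        exact ⟨j, hj.1, hj.2.1, by rw [hj.2.2, hl]; simp, fun h => absurd h hji⟩
    · have h := h2 (n i) (lam i)
      have hmem : i ∈ S.filter (fun k => n k = n i ∧ lam k = lam i) := by simp [hi]
      have hpos := Finset.card_pos.2 ⟨i, hmem⟩
      rw [h] at hpos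
      obtain ⟨j, hj⟩ := Finset.card_pos.1 hpos
      simp only [Finset.mem_filter] at hj
      refine ⟨j, hj.1, hj.2.1, hj.2.2, ?_⟩
      rintro rfl
      have := hj.2.2
      exact absurd (by linarith) hl
  obtain ⟨j, hj, hnj, hlj, hji⟩ := key
  have hcard : ((S.erase i).erase j).card < c := by
    rw [← hS]
    exact lt_of_le_of_lt (Finset.card_le_card (Finset.erase_subset _ _))
      (Finset.card_erase_lt_of_mem hi)
  have hcount : ∀ (P : Fin p → Prop) [DecidablePred P], (S.filter P).card =
      (((S.erase i).erase j).filter P).card + (if P i then 1 else 0)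
        + (if j ≠ i ∧ P j then 1 else 0) := by
    intro P _
    have hA : ∀ (T : Finset (Fin p)) (k : Fin p), k ∈ T → (T.filter P).card =
        ((T.erase k).filter P).card + (if P k then 1 else 0) := by
      intro T k hk
      rw [Finset.filter_erase]
      split_ifs with hP
      · rw [Finset.card_erase_add_one]; simp [hk, hP]
      · rw [Finset.erase_eq_of_notMem]; simp
        simp [hP]
    by_cases hij : j = i
    · subst hij
      rw [hA S j hj]; simp
    · rw [hA S i hi, hA (S.erase i) j (by simp [hij, hj])]
      simp [hij]; ring
  obtain ⟨τ, hτ⟩ := ih _ hcard ((S.erase i).erase j) rfl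
    (by
      intro l hl
      have h := h1 l hl
      rw [hcount] at h
      by_cases hA : n i = l ∧ lam i = 0
      · have hne : j ≠ i := by
          intro h; have := hji h; rw [hA.1] at this
          exact (Nat.not_even_iff_odd.2 hl) this
        have hB : n j = l ∧ lam j = 0 := ⟨by rw [hnj, hA.1], by rw [hlj, hA.2]; simp⟩
        rw [if_pos hA, if_pos ⟨hne, hB⟩] at h
        simpa [parity_simps, add_assoc] using h
      · have hB : ¬ (n j = l ∧ lam j = 0) := by
          rintro ⟨h, h'⟩; exact hA ⟨by rw [← hnj, h], by linarith⟩
        rw [if_neg hA, if_neg (fun h => hB h.2)] at h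
        simpa using h)
    (by
      intro l μ
      have h := h2 l μ
      rw [hcount, hcount] at h
      have e1 : (n j = l ∧ lam j = μ) ↔ (n i = l ∧ lam i = -μ) := by
        rw [hnj, hlj]; constructor <;> rintro ⟨a, b⟩ <;> exact ⟨a, by linarith⟩
      have e2 : (n j = l ∧ lam j = -μ) ↔ (n i = l ∧ lam i = μ) := by
        rw [hnj, hlj]; constructor <;> rintro ⟨a, b⟩ <;> exact ⟨a, by linarith⟩
      by_cases hij : j = i
      · subst hij
        simp only [ne_eq, not_true_eq_false, false_and, if_false, add_zero] at h
        have e3 : (if n j = l ∧ lam j = μ then 1 else 0) =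
          (if n j = l ∧ lam j = -μ then 1 else 0) := if_congr e1 rfl rfl |>.trans (by simp)
        rw [e3] at h
        exact Nat.add_right_cancel h
      · simp only [e1, e2, hij, ne_eq, not_false_eq_true, true_and] at h
        omega)
  refine ⟨fun k => if k = i then j else if k = j then i else τ k, ?_⟩
  intro k hk
  by_cases hki : k = i
  · subst hki
    by_cases hjk : j = k
    · subst hjk
      simp only [if_true, hj, true_and]
      exact ⟨hlj, fun _ => hji rfl⟩
    · simp [hjk, hj, hnj, hlj]
  · by_cases hkj : k = j
    · subst hkj
      simp [hki, hi, hnj, hlj]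
      intro h; exact absurd h.symm hki
    · have := hτ k (by simp [hki, hkj, hk])
      obtain ⟨t1, t2, t3, t4, t5⟩ := this
      simp only [Finset.mem_erase] at t1
      simp [hki, hkj, t1, t2, t3, t4]
      exact t5

lemma blockDiagJ_apply {p : ℕ} (n : Fin p → ℕ) (lam : Fin p → ℝ) (x y : Σ i, Fin (n i)) :
    Matrix.blockDiagonal' (fun i => jordanBlock (n i) (lam i)) x y =
      if x.1 = y.1 then (if (y.2 : ℕ) = x.2 then lam x.1 else
        if (y.2 : ℕ) = (x.2 : ℕ) + 1 then 1 else 0) else 0 := by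
  obtain ⟨i, a⟩ := x
  obtain ⟨j, b⟩ := y
  by_cases h : i = j
  · subst h
    simp [jordanBlock, Fin.ext_iff]
  · rw [Matrix.blockDiagonal'_apply_ne _ _ _ h]; simp [h]

lemma backward {p : ℕ} (n : Fin p → ℕ) (lam : Fin p → ℝ) (τ : Fin p → Fin p)
    (h1 : ∀ i, τ (τ i) = i) (h2 : ∀ i, n (τ i) = n i) (h3 : ∀ i, lam (τ i) = - lam i)
    (h4 : ∀ i, τ i = i → Even (n i)) :
    ∃ B : Matrix (Σ i, Fin (n i)) (Σ i, Fin (n i)) ℝ,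
        Bᵀ = -B ∧ IsUnit B ∧
        B * Matrix.blockDiagonal' (fun i => jordanBlock (n i) (lam i))
          + (Matrix.blockDiagonal' (fun i => jordanBlock (n i) (lam i)))ᵀ * B = 0 := by
  let ε : Fin p → ℝ := fun i => if Even (n i) then 1 else if i < τ i then 1 else -1
  have hε : ∀ i, ε (τ i) = ε i * (-1) ^ (n i) := by
    intro i
    simp only [ε, h2, h1]
    by_cases he : Even (n i)
    · simp [he]
    · have hne : τ i ≠ i := fun h => he (h4 i h)
      simp only [he, if_false, (Nat.not_even_iff_odd.1 he).neg_one_pow]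
      rcases lt_or_gt_of_ne hne with h | h
      · simp [h, h.le, not_lt.2 h.le]
      · simp [h, not_lt.2 h.le]
  have hε2 : ∀ i, ε i * ε i = 1 := by
    intro i; simp only [ε]; split_ifs <;> simp
  let e : (Σ i, Fin (n i)) → (Σ i, Fin (n i)) := fun x =>
    ⟨τ x.1, ⟨n x.1 - 1 - x.2, by rw [h2]; have := x.2.2; omega⟩⟩
  have hext : ∀ x y : (Σ i, Fin (n i)), x.1 = y.1 → (x.2 : ℕ) = y.2 → x = y := by
    rintro ⟨i, a⟩ ⟨j, b⟩ h h'
    dsimp at h; subst h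
    congr; exact Fin.ext h'
  have he : ∀ x, e (e x) = x := by
    intro x
    apply hext
    · exact h1 _
    · simp only [e, h2]; have := x.2.2; omega
  let s : (Σ i, Fin (n i)) → ℝ := fun x => ε x.1 * (-1) ^ (x.2 : ℕ)
  have hpp : ∀ a : ℕ, (-1 : ℝ) ^ a * (-1) ^ a = 1 := by
    intro a; rw [← mul_pow]; simp
  have hs2 : ∀ x, s x * s x = 1 := by
    intro x; simp only [s]
    linear_combination (ε x.1 * ε x.1) * hpp x.2 + hε2 x.1
  have hse : ∀ x, s (e x) = - s x := by
    intro x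
    have hx := x.2.2
    simp only [s, e, hε]
    obtain ⟨b, hb⟩ : ∃ b, n x.1 = x.2 + b + 1 := ⟨n x.1 - 1 - x.2, by omega⟩
    have : n x.1 - 1 - x.2 = b := by omega
    have hb2 : (-1 : ℝ) ^ (n x.1) = (-1) ^ (x.2 : ℕ) * (-1) ^ b * (-1) := by
      rw [congrArg (fun t => (-1 : ℝ) ^ t) hb, pow_add, pow_add, pow_one]
    rw [this, hb2]
    linear_combination (-ε x.1 * (-1) ^ (x.2 : ℕ)) * hpp b
  let B : Matrix (Σ i, Fin (n i)) (Σ i, Fin (n i)) ℝ := Matrix.of fun x y =>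
    if e x = y then s x else 0
  have hBt : Bᵀ = -B := by
    ext x y
    simp only [B, Matrix.transpose_apply, Matrix.of_apply, Matrix.neg_apply]
    by_cases h : e x = y
    · have h' : e y = x := by rw [← h, he]
      rw [if_pos h, if_pos h', ← h, hse]
    · have h' : ¬ e y = x := by rintro rfl; exact h (he y)
      rw [if_neg h, if_neg h']; simp
  refine ⟨B, hBt, ?_, ?_⟩
  · have : B * Bᵀ = 1 := by
      ext x y
      simp only [B, Matrix.mul_apply, Matrix.transpose_apply, Matrix.of_apply, Matrix.one_apply]
      simp
      by_cases h : x = y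
      · subst h; simp [hs2]
      · have : ¬ e y = e x := by
          intro h'; apply h; rw [← he x, ← h', he]
        simp [h, Ne.symm this]
    exact IsUnit.of_mul_eq_one _ this
  · ext x y
    have hB2 : ∀ z, B z y = if e y = z then s z else 0 := by
      intro z
      simp only [B, Matrix.of_apply]
      by_cases h : e z = y
      · have h' : e y = z := by rw [← h, he]
        simp [h, h']
      · have h' : ¬ e y = z := by rintro rfl; exact h (he y)
        simp [h, h']
    rw [Matrix.add_apply, Matrix.mul_apply, Matrix.mul_apply]
    simp only [Matrix.transpose_apply, hB2]
    simp only [B, Matrix.of_apply, ite_mul, mul_ite, zero_mul, mul_zero,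
      Finset.sum_ite_eq, Finset.mem_univ, if_true, hse, Matrix.zero_apply]
    rw [blockDiagJ_apply, blockDiagJ_apply]
    obtain ⟨i, a⟩ := x
    obtain ⟨j, b⟩ := y
    by_cases hij : τ i = j
    · subst hij
      have ha := a.2
      have hb := b.2
      have hb' : (b : ℕ) < n i := (h2 i) ▸ hb
      simp only [e, h1, h2, h3, if_true]
      by_cases hc : (a : ℕ) + b + 1 = n i
      · rw [if_pos (by omega), if_pos (by omega)]
        have : (⟨τ i, b⟩ : Σ i, Fin (n i)) = e ⟨i, a⟩ := hext _ _ rfl (by simp only [e]; omega)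
        rw [this, hse]; ring
      · have q1 : ¬ ((b : ℕ) = n i - 1 - a) := by omega
        have q2 : ¬ ((a : ℕ) = n i - 1 - b) := by omega
        simp only [q1, q2, if_false]
        by_cases hd : (a : ℕ) + b = n i
        · rw [if_pos (by omega), if_pos (by omega)]
          simp only [s, hε]
          have hd2 : (-1 : ℝ) ^ (n i) = (-1) ^ (a : ℕ) * (-1) ^ (b : ℕ) := by
            rw [← pow_add]; exact congrArg (fun t => (-1 : ℝ) ^ t) hd.symm
          rw [hd2]
          linear_combination (-ε i * (-1) ^ (a : ℕ)) * hpp b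
        · rw [if_neg (by omega), if_neg (by omega)]; simp
    · have hij' : ¬ τ j = i := by rintro rfl; exact hij (h1 j)
      simp [e, hij, hij']

lemma rank_neg' {m : Type*} [Fintype m] [DecidableEq m] (A : Matrix m m ℝ) :
    (-A).rank = A.rank := by
  have : -A = (-1 : Matrix m m ℝ) * A := by simp
  rw [this, Matrix.rank_mul_eq_right_of_isUnit_det]
  exact (Matrix.isUnit_iff_isUnit_det _).1 (isUnit_one.neg)

lemma even_rank_of_skew {m : Type*} [Fintype m] [DecidableEq m] (A : Matrix m m ℝ)
    (hA : Aᵀ = -A) : Even A.rank := by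
  have H := Matrix.exists_rank_normal_form A
  obtain ⟨r, hr⟩ : ∃ r, A.rank = r := ⟨_, rfl⟩
  rw [hr] at H ⊢
  obtain ⟨V, U, e, hV, hU, h⟩ := H
  have hVd := (Matrix.isUnit_iff_isUnit_det _).1 hV
  have hUd := (Matrix.isUnit_iff_isUnit_det _).1 hU
  set C := V * A * Vᵀ with hC
  have hCt : Cᵀ = -C := by
    simp [hC, Matrix.transpose_mul, hA, Matrix.mul_assoc]
  have hCr : C.rank = r := by
    rw [hC, Matrix.rank_mul_eq_left_of_isUnit_det, Matrix.rank_mul_eq_right_of_isUnit_det _ _ hVd,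
      hr]
    rw [Matrix.det_transpose]; exact hVd
  set D := C.submatrix e.symm e.symm with hD
  have hDr : D.rank = r := by rw [hD, Matrix.rank_submatrix, hCr]
  have hDt : Dᵀ = -D := by
    rw [hD, Matrix.transpose_submatrix, hCt]; rfl
  have hrow : ∀ k y, D (Sum.inr k) y = 0 := by
    intro k y
    have : C = (V * A * U) * (U⁻¹ * Vᵀ) := by
      rw [hC, ← Matrix.mul_assoc, Matrix.mul_assoc (V * A) U, Matrix.mul_nonsing_inv _ hUd,
        Matrix.mul_one]
    rw [hD, Matrix.submatrix_apply, this, h, Matrix.mul_apply]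
    apply Finset.sum_eq_zero
    intro z _
    rw [Matrix.submatrix_apply]
    rcases e z with w | w <;> simp
  have hcol : ∀ k y, D y (Sum.inr k) = 0 := by
    intro k y
    have := congrFun (congrFun hDt (Sum.inr k)) y
    rw [Matrix.transpose_apply, Matrix.neg_apply, hrow] at this
    simpa using this
  set S := D.toBlocks₁₁ with hS
  have hDS : D = Matrix.fromBlocks S 0 0 0 := by
    ext x y
    rcases x with x | x <;> rcases y with y | y <;> simp [hS, Matrix.toBlocks₁₁, hrow, hcol]
  have hSt : Sᵀ = -S := by
    ext x y
    exact congrFun (congrFun hDt (Sum.inl x)) (Sum.inl y)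
  by_contra hodd
  have hdet : S.det = 0 := by
    have h1 : S.det = (-S).det := by rw [← hSt, Matrix.det_transpose]
    rw [Matrix.det_neg, Fintype.card_fin, (Nat.not_even_iff_odd.1 hodd).neg_one_pow] at h1
    linarith
  obtain ⟨v, hv, hv0⟩ := Matrix.exists_mulVec_eq_zero_iff.2 hdet
  have hlt : S.rank < r := by
    have h2 := S.rank_le_card_width
    rw [Fintype.card_fin] at h2
    refine lt_of_le_of_ne h2 ?_
    intro h3
    have h4 := LinearMap.finrank_range_add_finrank_ker S.mulVecLin
    rw [Module.finrank_fin_fun] at h4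
    have h5 : Module.finrank ℝ (LinearMap.range S.mulVecLin) = r := h3
    have h6 : Module.finrank ℝ (LinearMap.ker S.mulVecLin) = 0 := by omega
    rw [Submodule.finrank_eq_zero] at h6
    have : v ∈ LinearMap.ker S.mulVecLin := by simpa using hv0
    rw [h6] at this
    exact hv (by simpa using this)
  have hle : D.rank ≤ S.rank := by
    have : D = Matrix.fromRows (1 : Matrix (Fin r) (Fin r) ℝ) 0 * S *
        Matrix.fromCols (1 : Matrix (Fin r) (Fin r) ℝ) 0 := by
      rw [hDS]
      ext x y
      rcases x with x | x <;> rcases y with y | y <;>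
        simp [Matrix.mul_fromCols, Matrix.fromRows_mul]
    rw [this]
    exact (Matrix.rank_mul_le_left _ _).trans (Matrix.rank_mul_le_right _ _)
  omega

lemma rank_blockDiag {p : ℕ} (n : Fin p → ℕ) (M : ∀ i, Matrix (Fin (n i)) (Fin (n i)) ℝ) :
    (Matrix.blockDiagonal' M).rank = ∑ i, (M i).rank := by
  classical
  have h : ∀ i, ∃ (V U : Matrix (Fin (n i)) (Fin (n i)) ℝ) (d : Fin (n i) → ℝ),
      IsUnit V ∧ IsUnit U ∧ V * M i * U = Matrix.diagonal d := by
    intro i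
    obtain ⟨V, U, e, hV, hU, h⟩ := Matrix.exists_rank_normal_form (M i)
    refine ⟨V, U, (Sum.elim 1 0) ∘ e, hV, hU, ?_⟩
    rw [h, ← Matrix.diagonal_one, ← Matrix.diagonal_zero, Matrix.fromBlocks_diagonal,
      Matrix.submatrix_diagonal_equiv]
    rfl
  choose V U d hV hU h using h
  have hVb : IsUnit (Matrix.blockDiagonal' V) := by
    have : IsUnit V := Pi.isUnit_iff.2 hV
    exact this.map (Matrix.blockDiagonal'RingHom (fun i => Fin (n i)) ℝ)
  have hUb : IsUnit (Matrix.blockDiagonal' U) := by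
    have : IsUnit U := Pi.isUnit_iff.2 hU
    exact this.map (Matrix.blockDiagonal'RingHom (fun i => Fin (n i)) ℝ)
  have hR : ∀ i, (M i).rank = Fintype.card {a // d i a ≠ 0} := by
    intro i
    rw [← Matrix.rank_diagonal, ← h i, Matrix.rank_mul_eq_left_of_isUnit_det _ _
      ((Matrix.isUnit_iff_isUnit_det _).1 (hU i)), Matrix.rank_mul_eq_right_of_isUnit_det _ _
      ((Matrix.isUnit_iff_isUnit_det _).1 (hV i))]
  have hb : Matrix.blockDiagonal' V * Matrix.blockDiagonal' M * Matrix.blockDiagonal' U =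
      Matrix.diagonal (fun x => d x.1 x.2) := by
    rw [← Matrix.blockDiagonal'_mul, ← Matrix.blockDiagonal'_mul]
    simp only [h, Matrix.blockDiagonal'_diagonal]
  rw [← Matrix.rank_mul_eq_right_of_isUnit_det _ _ ((Matrix.isUnit_iff_isUnit_det _).1 hVb),
    ← Matrix.rank_mul_eq_left_of_isUnit_det _ _ ((Matrix.isUnit_iff_isUnit_det _).1 hUb), hb,
    Matrix.rank_diagonal]
  simp only [hR]
  simp only [Fintype.card_subtype]
  rw [← Finset.univ_sigma_univ, ]
  simp only [Finset.card_filter, Finset.sum_sigma]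

lemma shift_pow (n k : ℕ) (i j : Fin n) :
    (jordanBlock n 0 ^ k) i j = if (j : ℕ) = i + k then 1 else 0 := by
  induction k generalizing i j with
  | zero => simp [Matrix.one_apply, Fin.ext_iff, eq_comm]
  | succ k ih =>
    rw [pow_succ', Matrix.mul_apply]
    simp only [ih]
    simp only [jordanBlock, Matrix.of_apply]
    have hh : ∀ x : Fin n, ((if x = i then (0:ℝ) else if (x : ℕ) = i + 1 then 1 else 0) *
        (if (j : ℕ) = x + k then 1 else 0)) =
        if (x : ℕ) = i + 1 then (if (j : ℕ) = i + (k + 1) then 1 else 0) else 0 := by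
      intro x
      by_cases h1 : (x : ℕ) = i + 1
      · have h2 : x ≠ i := by rintro rfl; omega
        simp [h1, h2, add_assoc, add_comm 1 k]
      · simp [h1]
    simp only [hh]
    by_cases hi : (i : ℕ) + 1 < n
    · rw [Finset.sum_eq_single (⟨i + 1, hi⟩ : Fin n)]
      · simp
      · intro b _ hb
        rw [if_neg]; intro h; exact hb (Fin.ext h)
      · simp
    · rw [Finset.sum_eq_zero]
      · rw [if_neg]; omega
      · intro x _; rw [if_neg]; omega

lemma rank_shift_pow (n k : ℕ) : (jordanBlock n 0 ^ k).rank = n - k := by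
  classical
  rw [← Matrix.rank_self_mul_transpose]
  have : jordanBlock n 0 ^ k * (jordanBlock n 0 ^ k)ᵀ =
      Matrix.diagonal (fun i : Fin n => if (i : ℕ) < n - k then (1 : ℝ) else 0) := by
    ext i j
    rw [Matrix.mul_apply, Matrix.diagonal_apply]
    simp only [Matrix.transpose_apply, shift_pow]
    by_cases hi : (i : ℕ) < n - k
    · rw [Finset.sum_eq_single (⟨i + k, by omega⟩ : Fin n)]
      · simp [hi, Fin.ext_iff]
      · intro b _ hb
        rw [if_neg, zero_mul]
        intro h; exact hb (Fin.ext h)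
      · simp
    · rw [Finset.sum_eq_zero]
      · simp [hi]
      · intro x _; rw [if_neg, zero_mul]; omega
  rw [this, Matrix.rank_diagonal]
  have e : {i : Fin n // (if (i : ℕ) < n - k then (1 : ℝ) else 0) ≠ 0} ≃ Fin (n - k) :=
    { toFun := fun x => ⟨x.1, by by_contra h; exact x.2 (by simp [h])⟩
      invFun := fun y => ⟨⟨y, by omega⟩, by simp⟩
      left_inv := fun x => by simp
      right_inv := fun y => by simp }
  rw [Fintype.card_congr e, Fintype.card_fin]

lemma jordan_sub (n : ℕ) (lam μ : ℝ) :
    jordanBlock n lam - μ • (1 : Matrix (Fin n) (Fin n) ℝ) = jordanBlock n (lam - μ) := by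
  ext i j
  by_cases h : j = i
  · simp [jordanBlock, h]
  · simp [jordanBlock, h, Matrix.one_apply, Ne.symm h, eq_comm]

lemma rank_jordan_pow (n k : ℕ) (lam : ℝ) :
    (jordanBlock n lam ^ k).rank = if lam = 0 then n - k else n := by
  split_ifs with h
  · rw [h, rank_shift_pow]
  · rw [Matrix.rank_of_isUnit, Fintype.card_fin]
    apply IsUnit.pow
    rw [Matrix.isUnit_iff_isUnit_det]
    have hu : (jordanBlock n lam).IsUpperTriangular := by
      intro i j hij
      have h1 : (j : ℕ) < i := hij
      simp only [jordanBlock, Matrix.of_apply]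
      rw [if_neg (by intro h; subst h; omega), if_neg (by omega)]
    rw [Matrix.det_of_isUpperTriangular hu]
    simp [jordanBlock, h]

lemma rank_full {p : ℕ} (n : Fin p → ℕ) (lam : Fin p → ℝ) (μ : ℝ) (k : ℕ) :
    ((Matrix.blockDiagonal' (fun i => jordanBlock (n i) (lam i)) -
      μ • (1 : Matrix (Σ i, Fin (n i)) (Σ i, Fin (n i)) ℝ)) ^ k).rank =
      ∑ i, if lam i = μ then n i - k else n i := by
  rw [← Matrix.blockDiagonal'_one, ← Matrix.blockDiagonal'_smul, ← Matrix.blockDiagonal'_sub,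
    ← Matrix.blockDiagonal'_pow, rank_blockDiag]
  apply Finset.sum_congr rfl
  intro i _
  have : ((fun i => jordanBlock (n i) (lam i)) - μ • (1 : ∀ i, Matrix (Fin (n i)) (Fin (n i)) ℝ)) i
    = jordanBlock (n i) (lam i - μ) := by
    rw [← jordan_sub]; rfl
  rw [Pi.pow_apply, this, rank_jordan_pow]
  simp only [sub_eq_zero]

lemma count_eq {p : ℕ} (n : Fin p → ℕ) (lam : Fin p → ℝ) (μ : ℝ) (l : ℕ) :
    (Finset.univ.filter (fun i => n i = l + 1 ∧ lam i = μ)).card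
      + 2 * (∑ i, if lam i = μ then n i - (l + 1) else n i)
      = (∑ i, if lam i = μ then n i - l else n i)
        + (∑ i, if lam i = μ then n i - (l + 2) else n i) := by
  rw [Finset.card_filter, Finset.mul_sum, ← Finset.sum_add_distrib, ← Finset.sum_add_distrib]
  apply Finset.sum_congr rfl
  intro i _
  by_cases h : lam i = μ
  · simp only [h, and_true, if_true]; split_ifs <;> omega
  · simp only [h, and_false, if_false]; omega

/-- An even-dimensional real-eigenvalue Jordan matrix admits an invertible skew-symmetric
solution of `B𝒥 + 𝒥ᵀB = 0` iff odd-sized nilpotent blocks come in pairs and blocks for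
`μ` and `-μ` are matched in size and number. -/
theorem exists_invertible_solution_iff_real
    (p : ℕ) (hp : 1 ≤ p) (n : Fin p → ℕ) (hn : ∀ i, 1 ≤ n i) (lam : Fin p → ℝ)
    (hN : Even (∑ i, n i)) :
    (∃ B : Matrix (Σ i, Fin (n i)) (Σ i, Fin (n i)) ℝ,
        Bᵀ = -B ∧ IsUnit B ∧
        B * Matrix.blockDiagonal' (fun i => jordanBlock (n i) (lam i))
          + (Matrix.blockDiagonal' (fun i => jordanBlock (n i) (lam i)))ᵀ * B = 0) ↔
      ((∀ l : ℕ, Odd l →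
          Even (Finset.univ.filter (fun i => n i = l ∧ lam i = 0)).card) ∧
       (∀ l : ℕ, 1 ≤ l → ∀ μ : ℝ,
          (Finset.univ.filter (fun i => n i = l ∧ lam i = μ)).card
            = (Finset.univ.filter (fun i => n i = l ∧ lam i = -μ)).card)) := by
  constructor
  · rintro ⟨B, hBt, hBu, hBJ⟩
    have hBd := (Matrix.isUnit_iff_isUnit_det _).1 hBu
    set J := Matrix.blockDiagonal' (fun i => jordanBlock (n i) (lam i)) with hJ
    have hsemi : ∀ (μ : ℝ) (k : ℕ), B * (J - μ • 1) ^ k = (-(J - (-μ) • 1)ᵀ) ^ k * B := by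
      intro μ k
      have h : SemiconjBy B (J - μ • 1) (-(J - (-μ) • 1)ᵀ) := by
        have h0 := eq_neg_of_add_eq_zero_left hBJ
        simp only [SemiconjBy, Matrix.transpose_sub, Matrix.transpose_smul, Matrix.transpose_one,
          mul_sub, neg_mul, sub_mul, h0, Matrix.mul_smul, Matrix.smul_mul, mul_one,
          one_mul]
        rw [neg_smul]
        abel
      exact (h.pow_right k)
    constructor
    · intro l hl
      have hev : ∀ k : ℕ, Even k → Even (∑ i, if lam i = 0 then n i - k else n i) := by
        intro k hk
        rw [← rank_full, ← hJ, ← Matrix.rank_mul_eq_right_of_isUnit_det B _ hBd]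
        apply even_rank_of_skew
        have h := hsemi 0 k
        rw [hk.neg_pow] at h
        simp only [neg_zero, zero_smul, sub_zero] at h ⊢
        rw [Matrix.transpose_mul, hBt, Matrix.transpose_pow, h, mul_neg]
      obtain ⟨m, rfl⟩ := hl
      have hc := count_eq n lam 0 (2 * m)
      obtain ⟨a, ha⟩ := hev (2 * m) (by simp)
      obtain ⟨b, hb⟩ := hev (2 * m + 2) (by simp [parity_simps])
      rw [ha, hb] at hc
      rw [Nat.even_iff]
      omega
    · intro l hl μ
      have hr : ∀ k : ℕ, (∑ i, if lam i = μ then n i - k else n i)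
          = ∑ i, if lam i = -μ then n i - k else n i := by
        intro k
        rw [← rank_full, ← rank_full, ← hJ, ← Matrix.rank_mul_eq_right_of_isUnit_det B _ hBd,
          hsemi, Matrix.rank_mul_eq_left_of_isUnit_det _ _ hBd]
        rcases Nat.even_or_odd k with hk | hk
        · rw [hk.neg_pow, ← Matrix.transpose_pow, Matrix.rank_transpose]
        · rw [hk.neg_pow, rank_neg', ← Matrix.transpose_pow, Matrix.rank_transpose]
      obtain ⟨m, rfl⟩ : ∃ m, l = m + 1 := ⟨l - 1, by omega⟩
      have c1 := count_eq n lam μ m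
      have c2 := count_eq n lam (-μ) m
      rw [hr, hr m, hr (m + 2)] at c1
      omega
  · rintro ⟨h1, h2⟩
    obtain ⟨τ, hτ⟩ := exists_pairing n lam _ Finset.univ rfl h1 (by
      intro l μ
      rcases Nat.eq_zero_or_pos l with rfl | hl
      · have : ∀ i, n i ≠ 0 := fun i => by have := hn i; omega
        simp [this]
      · exact h2 l hl μ)
    exact backward n lam τ (fun i => (hτ i (by simp)).2.1) (fun i => (hτ i (by simp)).2.2.1)
      (fun i => (hτ i (by simp)).2.2.2.1) (fun i => (hτ i (by simp)).2.2.2.2)
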